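/- (Stefanov–Uhlmann identity) Let V₁, V₂ be C¹ vector fields on ℝ^n generating flows X₁(s, X⁽⁰⁾), X₂(s, X⁽⁰⁾). Fix t > 0 and an initial point X⁽⁰⁾, and suppose X₁(t, X⁽⁰⁾) = X₂(t, X⁽⁰⁾). Then ∫₀ᵗ (∂X₂/∂X⁽⁰⁾)(t−s, X₁(s, X⁽⁰⁾)) · (V₁ − V₂)(X₁(s, X⁽⁰⁾)) ds = 0. -/

import Mathlib

open MeasureTheory intervalIntegral
noncomputable section

open Set Metric Filter Topology
open scoped NNReal

section ODE

variable {E : Type*} [NormedAddCommGroup E] [NormedSpace ℝ E] {V : E → E} {X : ℝ → E → E}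

theorem flow_continuous_time (hX : ∀ s y, HasDerivAt (fun u => X u y) (V (X s y)) s) (y : E) :
    Continuous fun s => X s y :=
  continuous_iff_continuousAt.2 fun s => (hX s y).continuousAt

/-- The first-order Taylor remainder of a `C¹` map is uniformly small along a compact set. -/
theorem ContDiff.uniform_taylor_remainder (hV : ContDiff ℝ 1 V) {S : Set E} (hS : IsCompact S)
    {ε : ℝ} (hε : 0 < ε) :
    ∃ δ > 0, ∀ x ∈ S, ∀ z ∈ ball x δ, ‖V z - V x - fderiv ℝ V x (z - x)‖ ≤ ε * ‖z - x‖ := by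
  have h := hS.uniformContinuousAt_of_continuousAt (fderiv ℝ V)
    (fun x _ => (hV.continuous_fderiv one_ne_zero).continuousAt) (dist_mem_uniformity hε)
  obtain ⟨δ, hδ, h⟩ := mem_uniformity_dist.1 h
  refine ⟨δ, hδ, fun x hx z hz => ?_⟩
  refine Convex.norm_image_sub_le_of_norm_fderiv_le'
    (fun w _ => hV.differentiable one_ne_zero w) (fun w hw => ?_) (convex_ball x δ)
    (mem_ball_self hδ) hz
  have h₁ := h (a := x) (b := w) (by rw [dist_comm]; exact hw) hx
  rw [← dist_eq_norm, dist_comm]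
  exact le_of_lt h₁

variable [FiniteDimensional ℝ E]

/-- A Lipschitz map with bounded range that is the identity on a given closed ball. -/
theorem exists_lipschitz_cutoff {R : ℝ} (hR : 0 < R) :
    ∃ (g : E → E) (K : ℝ≥0), LipschitzWith K g ∧ (∀ x, ‖x‖ ≤ R → g x = x) ∧
      (∀ x, ‖g x‖ ≤ ‖x‖) ∧ ∀ x, ‖g x‖ ≤ R + 1 := by
  let χ : ContDiffBump (0 : E) := ⟨R, R + 1, hR, by linarith⟩
  have hsmooth : ContDiff ℝ 1 fun x : E => χ x • x := χ.contDiff.smul contDiff_id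
  have hsupp : HasCompactSupport fun x : E => χ x • x := χ.hasCompactSupport.smul_right
  obtain ⟨K, hK⟩ := hsmooth.lipschitzWith_of_hasCompactSupport hsupp one_ne_zero
  have hle : ∀ x : E, ‖χ x • x‖ ≤ ‖x‖ := fun x => by
    rw [norm_smul, Real.norm_of_nonneg χ.nonneg]
    exact mul_le_of_le_one_left (norm_nonneg x) χ.le_one
  refine ⟨fun x => χ x • x, K, hK, fun x hx => ?_, hle, fun x => ?_⟩
  · simp [χ.one_of_mem_closedBall (mem_closedBall_zero_iff.2 hx)]
  · rcases le_total ‖x‖ (R + 1) with h | h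
    · exact (hle x).trans h
    · simp only [χ.zero_of_le_dist (x := x) (by simpa using h), zero_smul, norm_zero]
      linarith

/-- Global existence for a time-dependent vector field that is globally Lipschitz in space. -/
theorem exists_solution_of_lipschitzWith {v : ℝ → E → E} {T : ℝ} {K : ℝ≥0} (hT : 0 ≤ T)
    (hlip : ∀ s ∈ Icc 0 T, LipschitzWith K (v s))
    (hcont : ∀ x, ContinuousOn (v · x) (Icc 0 T)) (x₀ : E) :
    ∃ α : ℝ → E, α 0 = x₀ ∧
      ∀ s ∈ Icc 0 T, HasDerivWithinAt α (v s (α s)) (Icc 0 T) s := by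
  obtain ⟨M, hM⟩ := isCompact_Icc.exists_bound_of_continuousOn (hcont 0)
  have hM0 : 0 ≤ M := (norm_nonneg _).trans (hM 0 (left_mem_Icc.2 hT))
  have hgrowth : ∀ s ∈ Icc 0 T, ∀ x, ‖v s x‖ ≤ K * ‖x‖ + M := fun s hs x => by
    have h₁ := (hlip s hs).dist_le_mul x 0
    rw [dist_eq_norm, dist_zero_right] at h₁
    linarith [norm_le_norm_sub_add (v s x) (v s 0), hM s hs]
  set R := max (gronwallBound ‖x₀‖ K M T) 1
  obtain ⟨g, Kg, hg, hgid, hgle, hgR⟩ :=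
    exists_lipschitz_cutoff (E := E) (R := R) (by positivity)
  have hR : 0 ≤ R := by positivity
  let L : ℝ≥0 := ⟨K * (R + 1) + M, by positivity⟩
  have hPL : IsPicardLindelof (fun s x => v s (g x)) (⟨0, left_mem_Icc.2 hT⟩ : Icc 0 T) x₀
      (L * ⟨T, hT⟩) 0 L (K * Kg) :=
    { lipschitzOnWith := fun s hs => ((hlip s hs).comp hg).lipschitzOnWith
      continuousOn := fun x _ => hcont (g x)
      norm_le := fun s hs x _ => (hgrowth s hs (g x)).trans (by
        change _ ≤ K * (R + 1) + M
        gcongr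
        exact hgR x)
      mul_max_le := by
        change (L : ℝ) * _ ≤ L * T - 0
        simp [hT] }
  obtain ⟨α, hα0, hα⟩ := hPL.exists_eq_forall_mem_Icc_hasDerivWithinAt₀
  have hbound : ∀ s ∈ Icc 0 T, ‖α s‖ ≤ R := fun s hs => by
    have h₁ := norm_le_gronwallBound_of_norm_deriv_right_le (δ := ‖x₀‖) (K := K) (ε := M)
      (HasDerivWithinAt.continuousOn hα)
      (fun s hs => (hα s (Ico_subset_Icc_self hs)).mono_of_mem_nhdsWithin
        (Icc_mem_nhdsGE_of_mem hs)) (by rw [← hα0])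
      (fun s hs => (hgrowth s (Ico_subset_Icc_self hs) _).trans (by gcongr; exact hgle _)) s hs
    exact h₁.trans ((gronwallBound_mono (norm_nonneg _) hM0 K.2 (by linarith [hs.2])).trans
      (le_max_left _ _))
  refine ⟨α, hα0, fun s hs => ?_⟩
  have h₁ := hα s hs
  rwa [hgid _ (hbound s hs)] at h₁

theorem ContDiff.exists_lipschitzOnWith_closedBall (hV : ContDiff ℝ 1 V) (R : ℝ) :
    ∃ K, LipschitzOnWith K V (closedBall 0 R) :=
  have := FiniteDimensional.proper_real E
  hV.locallyLipschitz.locallyLipschitzOn.exists_lipschitzOnWith_of_compact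
    (isCompact_closedBall 0 R)

/-- Two global integral curves of a `C¹` vector field with the same initial point agree. -/
theorem eq_of_hasDerivAt_of_contDiff (hV : ContDiff ℝ 1 V) {f g : ℝ → E}
    (hf : ∀ s, HasDerivAt f (V (f s)) s) (hg : ∀ s, HasDerivAt g (V (g s)) s)
    (h0 : f 0 = g 0) : f = g := by
  funext s
  have hfc : Continuous f := continuous_iff_continuousAt.2 fun u => (hf u).continuousAt
  have hgc : Continuous g := continuous_iff_continuousAt.2 fun u => (hg u).continuousAt
  set J := Icc (-(|s| + 1)) (|s| + 1)
  obtain ⟨A, hA⟩ := isCompact_Icc.exists_bound_of_continuousOn (s := J) hfc.continuousOn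
  obtain ⟨B, hB⟩ := isCompact_Icc.exists_bound_of_continuousOn (s := J) hgc.continuousOn
  obtain ⟨K, hK⟩ := hV.exists_lipschitzOnWith_closedBall (max A B)
  have hs : s ∈ Ioo (-(|s| + 1)) (|s| + 1) :=
    ⟨by linarith [neg_abs_le s], by linarith [le_abs_self s]⟩
  refine ODE_solution_unique_of_mem_Ioo (v := fun _ => V) (s := fun _ => closedBall 0 (max A B))
    (t₀ := 0) (fun _ _ => hK) ⟨by linarith [abs_nonneg s], by linarith [abs_nonneg s]⟩
    (fun u hu => ⟨hf u, ?_⟩) (fun u hu => ⟨hg u, ?_⟩) h0 hs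
  · exact mem_closedBall_zero_iff.2 ((hA u (Ioo_subset_Icc_self hu)).trans (le_max_left _ _))
  · exact mem_closedBall_zero_iff.2 ((hB u (Ioo_subset_Icc_self hu)).trans (le_max_right _ _))

theorem flow_add (hV : ContDiff ℝ 1 V) (hX0 : ∀ y, X 0 y = y)
    (hX : ∀ s y, HasDerivAt (fun u => X u y) (V (X s y)) s) (a b : ℝ) (y : E) :
    X (a + b) y = X a (X b y) := by
  have h := eq_of_hasDerivAt_of_contDiff hV (f := fun s => X (s + b) y)
    (g := fun s => X s (X b y)) (fun s => (hX (s + b) y).comp_add_const s b)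
    (fun s => hX s _) (by simp [hX0])
  exact congrFun h a

/-- On a bounded time interval, trajectories starting near a given point stay in a common ball. -/
theorem flow_mem_closedBall (hV : ContDiff ℝ 1 V) (hX0 : ∀ y, X 0 y = y)
    (hX : ∀ s y, HasDerivAt (fun u => X u y) (V (X s y)) s) {T : ℝ} (hT : 0 ≤ T) (y₀ : E) :
    ∃ r > 0, ∃ R : ℝ, ∀ y ∈ ball y₀ r, ∀ s ∈ Icc 0 T, X s y ∈ closedBall 0 R := by
  obtain ⟨A, hA⟩ := isCompact_Icc.exists_bound_of_continuousOn (s := Icc 0 T)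
    (flow_continuous_time hX y₀).continuousOn
  have hA0 : 0 ≤ A := (norm_nonneg _).trans (hA 0 (left_mem_Icc.2 hT))
  obtain ⟨g, Kg, hg, hgid, -, hgR⟩ :=
    exists_lipschitz_cutoff (E := E) (R := A + 1) (by positivity)
  obtain ⟨K, hK⟩ := hV.exists_lipschitzOnWith_closedBall (A + 1 + 1)
  have hW : LipschitzWith (K * Kg) (V ∘ g) := by
    rw [← lipschitzOnWith_univ]
    exact hK.comp hg.lipschitzOnWith fun x _ => mem_closedBall_zero_iff.2 (hgR x)
  set c : ℝ := ((K * Kg : ℝ≥0) : ℝ)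
  refine ⟨Real.exp (-(c * T)), Real.exp_pos _, A + 1, fun y hy => ?_⟩
  obtain ⟨α, hα0, hα⟩ := exists_solution_of_lipschitzWith (v := fun _ => V ∘ g) hT
    (fun _ _ => hW) (fun _ => continuousOn_const) y
  have hαc := HasDerivWithinAt.continuousOn hα
  have hα' : ∀ s ∈ Ico 0 T, HasDerivWithinAt α (V (g (α s))) (Ici s) s := fun s hs =>
    (hα s (Ico_subset_Icc_self hs)).mono_of_mem_nhdsWithin (Icc_mem_nhdsGE_of_mem hs)
  have hdist := dist_le_of_trajectories_ODE (v := fun _ => V ∘ g) (fun _ => hW) hαc hα'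
    (flow_continuous_time hX y₀).continuousOn
    (fun s hs => by
      have h := (hX s y₀).hasDerivWithinAt (s := Ici s)
      have hid := hgid (X s y₀) ((hA s (Ico_subset_Icc_self hs)).trans (by linarith))
      simpa only [Function.comp_apply, hid] using h)
    (δ := Real.exp (-(c * T))) (by rw [hα0, hX0]; exact (mem_ball.1 hy).le)
  have hαR : ∀ s ∈ Icc 0 T, ‖α s‖ ≤ A + 1 := fun s hs => by
    have h₁ : Real.exp (-(c * T)) * Real.exp (c * (s - 0)) ≤ 1 := by
      rw [← Real.exp_add, Real.exp_le_one_iff]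
      nlinarith [hs.2, show 0 ≤ c from (K * Kg).2]
    have h₂ := (hdist s hs).trans h₁
    rw [dist_eq_norm] at h₂
    linarith [norm_le_norm_sub_add (α s) (X s y₀), hA s hs]
  obtain ⟨B, hB⟩ := isCompact_Icc.exists_bound_of_continuousOn (s := Icc 0 T)
    (flow_continuous_time hX y).continuousOn
  obtain ⟨K', hK'⟩ := hV.exists_lipschitzOnWith_closedBall (max (A + 1) B)
  have heq : EqOn α (fun s => X s y) (Icc 0 T) :=
    ODE_solution_unique_of_mem_Icc_right (v := fun _ => V)
      (s := fun _ => closedBall 0 (max (A + 1) B)) (fun _ _ => hK') hαc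
      (fun s hs => by
        have h := hα' s hs
        rwa [hgid _ (hαR s (Ico_subset_Icc_self hs))] at h)
      (fun s hs => mem_closedBall_zero_iff.2
        ((hαR s (Ico_subset_Icc_self hs)).trans (le_max_left _ _)))
      (flow_continuous_time hX y).continuousOn (fun s _ => (hX s y).hasDerivWithinAt)
      (fun s hs => mem_closedBall_zero_iff.2
        ((hB s (Ico_subset_Icc_self hs)).trans (le_max_right _ _)))
      (by rw [hα0, hX0])
  intro s hs
  rw [← show α s = X s y from heq hs]
  exact mem_closedBall_zero_iff.2 (hαR s hs)

/-- The flow of a `C¹` vector field is Lipschitz near each point, uniformly on bounded times. -/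
theorem flow_lipschitzOnWith (hV : ContDiff ℝ 1 V) (hX0 : ∀ y, X 0 y = y)
    (hX : ∀ s y, HasDerivAt (fun u => X u y) (V (X s y)) s) {T : ℝ} (hT : 0 ≤ T) (y₀ : E) :
    ∃ r > 0, ∃ L : ℝ≥0, ∀ s ∈ Icc 0 T, LipschitzOnWith L (X s) (ball y₀ r) := by
  obtain ⟨r, hr, R, hR⟩ := flow_mem_closedBall hV hX0 hX hT y₀
  obtain ⟨K, hK⟩ := hV.exists_lipschitzOnWith_closedBall R
  refine ⟨r, hr, ⟨Real.exp (K * T), (Real.exp_pos _).le⟩, fun s hs => ?_⟩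
  refine LipschitzOnWith.of_dist_le_mul fun y hy z hz => ?_
  have h := dist_le_of_trajectories_ODE_of_mem (v := fun _ => V) (s := fun _ => closedBall 0 R)
    (fun _ _ => hK) (flow_continuous_time hX y).continuousOn
    (fun s _ => (hX s y).hasDerivWithinAt) (fun s hs => hR y hy s (Ico_subset_Icc_self hs))
    (flow_continuous_time hX z).continuousOn
    (fun s _ => (hX s z).hasDerivWithinAt) (fun s hs => hR z hz s (Ico_subset_Icc_self hs))
    le_rfl s hs
  rw [hX0, hX0, mul_comm] at h
  refine h.trans ?_
  change _ ≤ Real.exp (K * T) * _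
  gcongr
  linarith [hs.2]

theorem flow_continuousOn_uncurry (hV : ContDiff ℝ 1 V) (hX0 : ∀ y, X 0 y = y)
    (hX : ∀ s y, HasDerivAt (fun u => X u y) (V (X s y)) s) {T : ℝ} (hT : 0 ≤ T) :
    ContinuousOn (Function.uncurry X) (Icc 0 T ×ˢ univ) := by
  rintro ⟨s, y⟩ ⟨hs, -⟩
  obtain ⟨r, hr, L, hL⟩ := flow_lipschitzOnWith hV hX0 hX hT y
  have h := continuousOn_prod_of_continuousOn_lipschitzOnWith' (Function.uncurry X) L hL
    (fun z _ => (flow_continuous_time hX z).continuousOn)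
  refine (h (s, y) ⟨hs, mem_ball_self hr⟩).mono_of_mem_nhdsWithin ?_
  rw [nhdsWithin_prod_eq, nhdsWithin_univ]
  exact prod_mem_prod self_mem_nhdsWithin (ball_mem_nhds y hr)

/-- The flow of a `C¹` vector field is differentiable with respect to the initial point. -/
theorem flow_differentiableAt (hV : ContDiff ℝ 1 V) (hX0 : ∀ y, X 0 y = y)
    (hX : ∀ s y, HasDerivAt (fun u => X u y) (V (X s y)) s) {T : ℝ} (hT : 0 ≤ T) (y₀ : E) :
    DifferentiableAt ℝ (X T) y₀ := by
  have hγ := flow_continuous_time hX y₀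
  let A : ℝ → E →L[ℝ] E := fun s => fderiv ℝ V (X s y₀)
  have hA : Continuous A := (hV.continuous_fderiv one_ne_zero).comp hγ
  obtain ⟨M, hM⟩ := isCompact_Icc.exists_bound_of_continuousOn (s := Icc 0 T) hA.continuousOn
  have hM0 : 0 ≤ M := (norm_nonneg _).trans (hM 0 (left_mem_Icc.2 hT))
  obtain ⟨Φ, hΦ0, hΦ⟩ := exists_solution_of_lipschitzWith (K := ⟨M, hM0⟩)
    (v := fun s (Ψ : E →L[ℝ] E) => (A s).comp Ψ) hT
    (fun s hs => LipschitzWith.of_dist_le_mul fun Ψ Ψ' => by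
      rw [dist_eq_norm, dist_eq_norm, ← ContinuousLinearMap.comp_sub]
      refine (ContinuousLinearMap.opNorm_comp_le _ _).trans ?_
      exact mul_le_mul_of_nonneg_right (hM s hs) (norm_nonneg _))
    (fun Ψ => (hA.clm_comp continuous_const).continuousOn) (ContinuousLinearMap.id ℝ E)
  have hΦc := HasDerivWithinAt.continuousOn hΦ
  obtain ⟨r, hr, L, hL⟩ := flow_lipschitzOnWith hV hX0 hX hT y₀
  suffices HasFDerivAt (X T) (Φ T) y₀ from this.differentiableAt
  rw [hasFDerivAt_iff_isLittleO, Asymptotics.isLittleO_iff]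
  intro c hc
  set G := gronwallBound 0 M 1 T
  have hG : 0 ≤ G := by
    have h := gronwallBound_mono le_rfl zero_le_one hM0 hT
    rwa [gronwallBound_x0] at h
  have hC : 0 < (L : ℝ) * G + 1 := by positivity
  obtain ⟨δ, hδ, hTaylor⟩ := hV.uniform_taylor_remainder
    (isCompact_Icc.image (s := Icc 0 T) hγ) (div_pos hc hC)
  set ε := c / (L * G + 1)
  filter_upwards [ball_mem_nhds y₀ hr,
    ball_mem_nhds y₀ (div_pos hδ (show 0 < (L : ℝ) + 1 by positivity))] with y hy hyδ
  have hLip : ∀ s ∈ Icc 0 T, ‖X s y - X s y₀‖ ≤ L * ‖y - y₀‖ := fun s hs => by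
    simpa only [dist_eq_norm] using (hL s hs).dist_le_mul y hy y₀ (mem_ball_self hr)
  have hclose : ∀ s ∈ Icc 0 T, X s y ∈ ball (X s y₀) δ := fun s hs => by
    rw [mem_ball, lt_div_iff₀ (by positivity), dist_eq_norm] at hyδ
    rw [mem_ball, dist_eq_norm]
    nlinarith [hLip s hs, norm_nonneg (y - y₀)]
  have hbound := norm_le_gronwallBound_of_norm_deriv_right_le (a := 0) (b := T)
    (f := fun s => X s y - X s y₀ - Φ s (y - y₀))
    (f' := fun s => V (X s y) - V (X s y₀) - (A s).comp (Φ s) (y - y₀))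
    (δ := 0) (K := M) (ε := ε * (L * ‖y - y₀‖))
    (((flow_continuous_time hX y).sub hγ).continuousOn.sub (hΦc.clm_apply continuousOn_const))
    (fun s hs => by
      have h := (hΦ s (Ico_subset_Icc_self hs)).mono_of_mem_nhdsWithin
        (Icc_mem_nhdsGE_of_mem hs)
      have h' := h.clm_apply (hasDerivWithinAt_const s (Ici s) (y - y₀))
      rw [map_zero, add_zero] at h'
      exact ((hX s y).sub (hX s y₀)).hasDerivWithinAt.sub h')
    (by simp [hX0, hΦ0])
    (fun s hs => by
      have hs' := Ico_subset_Icc_self hs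
      have hsplit : V (X s y) - V (X s y₀) - (A s).comp (Φ s) (y - y₀) =
          A s (X s y - X s y₀ - Φ s (y - y₀)) +
            (V (X s y) - V (X s y₀) - A s (X s y - X s y₀)) := by
        simp only [ContinuousLinearMap.comp_apply, map_sub]
        abel
      rw [hsplit]
      refine (norm_add_le _ _).trans (add_le_add ?_ ?_)
      · exact (A s).le_of_opNorm_le (hM s hs') _
      · refine (hTaylor _ (mem_image_of_mem _ hs') _ (hclose s hs')).trans ?_
        gcongr
        exact hLip s hs')
    T (right_mem_Icc.2 hT)
  have hscale : ∀ η : ℝ, gronwallBound 0 M η T = η * G := fun η => by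
    by_cases h : M = 0
    · simp [G, gronwallBound, h]
    · simp [G, gronwallBound, h]
      ring
  rw [sub_zero, hscale] at hbound
  refine hbound.trans ?_
  have hεc : ε * (L * G) ≤ c := by
    rw [div_mul_eq_mul_div, div_le_iff₀ hC]
    nlinarith
  nlinarith [norm_nonneg (y - y₀)]

/-- The derivative of a flow transports the vector field along trajectories. -/
theorem fderiv_flow_apply (hV : ContDiff ℝ 1 V) (hX0 : ∀ y, X 0 y = y)
    (hX : ∀ s y, HasDerivAt (fun u => X u y) (V (X s y)) s) {τ : ℝ} (hτ : 0 ≤ τ) (y : E) :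
    fderiv ℝ (X τ) y (V y) = V (X τ y) := by
  have h₁ : HasDerivAt (fun h => X τ (X h y)) (fderiv ℝ (X τ) y (V y)) 0 := by
    have hd := (flow_differentiableAt hV hX0 hX hτ y).hasFDerivAt
    have h0 := hX 0 y
    rw [hX0] at h0
    exact HasFDerivAt.comp_hasDerivAt_of_eq (0 : ℝ) hd h0 (hX0 y).symm
  have h₂ : HasDerivAt (fun h => X h (X τ y)) (V (X τ y)) 0 := by
    simpa only [hX0] using hX 0 (X τ y)
  refine h₁.unique (h₂.congr_of_eventuallyEq (Eventually.of_forall fun h => ?_))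
  change X τ (X h y) = X h (X τ y)
  rw [← flow_add hV hX0 hX, ← flow_add hV hX0 hX, add_comm]

/-- Joint time derivative of a flow evaluated along a moving point. -/
theorem hasDerivAt_flow_comp (hV : ContDiff ℝ 1 V) (hX0 : ∀ y, X 0 y = y)
    (hX : ∀ s y, HasDerivAt (fun u => X u y) (V (X s y)) s) {q : ℝ → E} {q' : E} {t s : ℝ}
    (hst : s < t) (hq : HasDerivAt q q' s) :
    HasDerivAt (fun u => X (t - u) (q u)) (fderiv ℝ (X (t - s)) (q s) (q' - V (q s))) s := by
  have hτ : 0 < t - s := sub_pos.2 hst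
  have hspace : HasDerivAt (fun u => X (t - s) (q u)) (fderiv ℝ (X (t - s)) (q s) q') s :=
    (flow_differentiableAt hV hX0 hX hτ.le (q s)).hasFDerivAt.comp_hasDerivAt s hq
  have hjoint : ContinuousAt (fun p : ℝ × E => V (X p.1 p.2)) (t - s, q s) := by
    refine hV.continuous.continuousAt.comp ?_
    refine (flow_continuousOn_uncurry hV hX0 hX (T := t - s + 1) (by linarith)).continuousAt ?_
    exact prod_mem_nhds (Icc_mem_nhds hτ (by linarith)) univ_mem
  have htime : HasDerivAt (fun u => X (t - u) (q u) - X (t - s) (q u)) (-V (X (t - s) (q s)))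
      s := by
    rw [hasDerivAt_iff_isLittleO, Asymptotics.isLittleO_iff]
    intro c hc
    obtain ⟨δ, hδ, hclose⟩ := Metric.continuousAt_iff.1 hjoint c hc
    filter_upwards [hq.continuousAt (ball_mem_nhds (q s) hδ), ball_mem_nhds s hδ] with u hu hus
    have hmv := (convex_ball (t - s) δ).norm_image_sub_le_of_norm_hasDerivWithin_le
      (f := fun w => X w (q u) - w • V (X (t - s) (q s)))
      (f' := fun w => V (X w (q u)) - (1 : ℝ) • V (X (t - s) (q s))) (C := c)
      (x := t - s) (y := t - u)
      (fun w _ => ((hX w (q u)).sub ((hasDerivAt_id w).smul_const _)).hasDerivWithinAt)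
      (fun w hw => by
        rw [one_smul, ← dist_eq_norm]
        exact (hclose (x := (w, q u)) (max_lt hw hu)).le)
      (mem_ball_self hδ) (by
        rw [mem_ball, dist_eq_norm] at hus ⊢
        rwa [sub_sub_sub_cancel_left, norm_sub_rev])
    rw [sub_sub_sub_cancel_left, norm_sub_rev s u] at hmv
    convert hmv using 2
    module
  have h := htime.fun_add hspace
  rw [map_sub, fderiv_flow_apply hV hX0 hX hτ.le, sub_eq_neg_add]
  simpa using h

/-- The spatial derivative of a flow is bounded on bounded times and compact sets. -/
theorem exists_bound_fderiv_flow (hV : ContDiff ℝ 1 V) (hX0 : ∀ y, X 0 y = y)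
    (hX : ∀ s y, HasDerivAt (fun u => X u y) (V (X s y)) s) {T : ℝ} (hT : 0 ≤ T) {S : Set E}
    (hS : IsCompact S) : ∃ C, ∀ y ∈ S, ∀ s ∈ Icc 0 T, ‖fderiv ℝ (X s) y‖ ≤ C := by
  refine hS.induction_on (p := fun S => ∃ C, ∀ y ∈ S, ∀ s ∈ Icc 0 T, ‖fderiv ℝ (X s) y‖ ≤ C)
    ⟨0, by simp⟩ (fun A B hAB ⟨C, hC⟩ => ⟨C, fun y hy => hC y (hAB hy)⟩) ?_ ?_
  · rintro A B ⟨C, hC⟩ ⟨D, hD⟩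
    refine ⟨max C D, ?_⟩
    rintro y (hy | hy) s hs
    · exact (hC y hy s hs).trans (le_max_left _ _)
    · exact (hD y hy s hs).trans (le_max_right _ _)
  · intro y _
    obtain ⟨r, hr, L, hL⟩ := flow_lipschitzOnWith hV hX0 hX hT y
    exact ⟨ball y r, mem_nhdsWithin_of_mem_nhds (ball_mem_nhds y hr), L, fun z hz s hs =>
      norm_fderiv_le_of_lipschitzOn ℝ (isOpen_ball.mem_nhds hz) (hL s hs)⟩

end ODE

/-- The Stefanov–Uhlmann identity: if `X₁, X₂` are the flows of `C¹` vector fields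
`V₁, V₂` on `ℝⁿ` and `X₁(t, X⁰) = X₂(t, X⁰)`, then
`∫₀ᵗ (∂X₂/∂X⁰)(t−s, X₁(s,X⁰)) (V₁ − V₂)(X₁(s,X⁰)) ds = 0`. -/
theorem stefanov_uhlmann_identity
    (n : ℕ) (V₁ V₂ : (Fin n → ℝ) → (Fin n → ℝ))
    (hV₁ : ContDiff ℝ 1 V₁) (hV₂ : ContDiff ℝ 1 V₂)
    (X₁ X₂ : ℝ → (Fin n → ℝ) → (Fin n → ℝ))
    (hX₁0 : ∀ y, X₁ 0 y = y) (hX₂0 : ∀ y, X₂ 0 y = y)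
    (hX₁ : ∀ s y, HasDerivAt (fun u => X₁ u y) (V₁ (X₁ s y)) s)
    (hX₂ : ∀ s y, HasDerivAt (fun u => X₂ u y) (V₂ (X₂ s y)) s)
    (t : ℝ) (ht : 0 < t) (X0 : Fin n → ℝ)
    (hend : X₁ t X0 = X₂ t X0) :
    ∫ s in (0:ℝ)..t,
      (fderiv ℝ (X₂ (t - s)) (X₁ s X0)) (V₁ (X₁ s X0) - V₂ (X₁ s X0)) = 0 := by
  have hpath := flow_continuous_time hX₁ X0
  set F' : ℝ → Fin n → ℝ := fun s =>
    (fderiv ℝ (X₂ (t - s)) (X₁ s X0)) (V₁ (X₁ s X0) - V₂ (X₁ s X0))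
  have hderiv : ∀ s ∈ Ioo 0 t, HasDerivAt (fun u => X₂ (t - u) (X₁ u X0)) (F' s) s :=
    fun s hs => hasDerivAt_flow_comp hV₂ hX₂0 hX₂ hs.2 (hX₁ s X0)
  have hcont : ContinuousOn (fun u => X₂ (t - u) (X₁ u X0)) (Icc 0 t) :=
    (flow_continuousOn_uncurry hV₂ hX₂0 hX₂ ht.le).comp
      ((continuous_const.sub continuous_id).prodMk hpath).continuousOn
      fun s hs => ⟨⟨sub_nonneg.2 hs.2, sub_le_self t hs.1⟩, mem_univ _⟩
  have hint : IntervalIntegrable F' volume 0 t := by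
    rw [intervalIntegrable_iff_integrableOn_Ioo_of_le ht.le]
    obtain ⟨C, hC⟩ := exists_bound_fderiv_flow hV₂ hX₂0 hX₂ ht.le
      (isCompact_Icc.image (s := Icc 0 t) hpath)
    obtain ⟨D, hD⟩ := isCompact_Icc.exists_bound_of_continuousOn (s := Icc 0 t)
      ((hV₁.continuous.comp hpath).sub (hV₂.continuous.comp hpath)).continuousOn
    have hmeas : AEStronglyMeasurable F' (volume.restrict (Ioo 0 t)) :=
      (stronglyMeasurable_deriv fun u => X₂ (t - u) (X₁ u X0)).aestronglyMeasurable.congr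
        ((ae_restrict_mem measurableSet_Ioo).mono fun s hs => (hderiv s hs).deriv)
    refine Integrable.of_bound hmeas (C * D)
      ((ae_restrict_mem measurableSet_Ioo).mono fun s hs => ?_)
    have hs' := Ioo_subset_Icc_self hs
    have hCs := hC _ (mem_image_of_mem _ hs') (t - s) ⟨sub_nonneg.2 hs'.2, sub_le_self t hs'.1⟩
    exact ((fderiv ℝ (X₂ (t - s)) (X₁ s X0)).le_of_opNorm_le hCs _).trans
      (mul_le_mul_of_nonneg_left (hD s hs') ((norm_nonneg _).trans hCs))
  rw [integral_eq_sub_of_hasDerivAt_of_le ht.le hcont hderiv hint]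
  simp [hX₁0, hX₂0, hend]
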